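/- arXiv:math/0405448 — 2 statements merged into one kernel-verified Lean document; each statement's English description precedes it below -/
import Mathlib

section
/- Every two-dimensional reflexive polytope has at most six vertices. -/
open scoped BigOperators

noncomputable section

/-- The standard dot product on `ℝ^d`. -/
def dotProd {d : ℕ} (x y : Fin d → ℝ) : ℝ := ∑ i, x i * y i

/-- A point of `ℝ^d` is a lattice point (element of `ℤ^d`) if all coordinates are integers. -/
def IsLatticePoint {d : ℕ} (x : Fin d → ℝ) : Prop := ∀ i, ∃ n : ℤ, x i = (n : ℝ)

/-- A lattice polytope is the convex hull of finitely many lattice points. -/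
def IsLatticePolytope {d : ℕ} (P : Set (Fin d → ℝ)) : Prop :=
  ∃ V : Finset (Fin d → ℝ), (∀ v ∈ V, IsLatticePoint v) ∧ P = convexHull ℝ (V : Set (Fin d → ℝ))

/-- The dual polytope `P* = {y | ⟨x,y⟩ ≥ -1 ∀ x ∈ P}`. -/
def dualPolytope {d : ℕ} (P : Set (Fin d → ℝ)) : Set (Fin d → ℝ) :=
  {y | ∀ x ∈ P, -1 ≤ dotProd x y}

/-- A reflexive polytope: a full-dimensional lattice polytope with `0` in its interior whose
dual polytope is again a lattice polytope. -/
def IsReflexive {d : ℕ} (P : Set (Fin d → ℝ)) : Prop :=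
  IsLatticePolytope P ∧ (0 : Fin d → ℝ) ∈ interior P ∧ IsLatticePolytope (dualPolytope P)

/-- A face of `P`: the subset of `P` where some linear functional attains its maximum bound. -/
def IsFace {d : ℕ} (P F : Set (Fin d → ℝ)) : Prop :=
  ∃ (u : Fin d → ℝ) (c : ℝ), (∀ x ∈ P, dotProd u x ≤ c) ∧ F = {x ∈ P | dotProd u x = c}

/-- A facet of a `d`-dimensional polytope: a nonempty face of dimension `d - 1`. -/
def IsFacet {d : ℕ} (P F : Set (Fin d → ℝ)) : Prop :=
  IsFace P F ∧ F.Nonempty ∧ Module.finrank ℝ (vectorSpan ℝ F) = d - 1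

/-- `x ∼ y` : `x` and `y` lie in a common facet of `P`. -/
def SameFacet {d : ℕ} (P : Set (Fin d → ℝ)) (x y : Fin d → ℝ) : Prop :=
  ∃ F, IsFacet P F ∧ x ∈ F ∧ y ∈ F

/-- The star set of `x`: the union of all facets of `P` containing `x`. -/
def starSet {d : ℕ} (P : Set (Fin d → ℝ)) (x : Fin d → ℝ) : Set (Fin d → ℝ) :=
  {y | SameFacet P x y}

/-- A family of lattice points forming a `ℤ`-basis of the lattice `ℤ^d`. -/
def IsZBasisFamily {d n : ℕ} (s : Fin n → (Fin d → ℝ)) : Prop :=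
  LinearIndependent ℝ s ∧ (∀ i, IsLatticePoint (s i)) ∧
    ∀ z : Fin d → ℝ, IsLatticePoint z → ∃ c : Fin n → ℤ, z = ∑ i, (c i : ℝ) • s i

/-- A primitive lattice point: a nonzero lattice point such that no lattice point lies
strictly between `0` and it. -/
def IsPrimitivePoint {d : ℕ} (x : Fin d → ℝ) : Prop :=
  IsLatticePoint x ∧ x ≠ 0 ∧ ∀ y ∈ openSegment ℝ (0 : Fin d → ℝ) x, ¬ IsLatticePoint y

/-- A Fano polytope: a full-dimensional lattice polytope with `0` in its interior all of whose
vertices are primitive lattice points. -/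
def IsFanoPolytope {d : ℕ} (P : Set (Fin d → ℝ)) : Prop :=
  IsLatticePolytope P ∧ (0 : Fin d → ℝ) ∈ interior P ∧
    ∀ v ∈ Set.extremePoints ℝ P, IsPrimitivePoint v

/-- Canonical: the only interior lattice point is the origin. -/
def IsCanonicalPolytope {d : ℕ} (P : Set (Fin d → ℝ)) : Prop :=
  {x ∈ interior P | IsLatticePoint x} = {0}

/-- Terminal: the only lattice points of `P` are the origin and the vertices. -/
def IsTerminalPolytope {d : ℕ} (P : Set (Fin d → ℝ)) : Prop :=
  {x ∈ P | IsLatticePoint x} = insert (0 : Fin d → ℝ) (Set.extremePoints ℝ P)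

/-- Simplicial: every facet has exactly `d` vertices. -/
def IsSimplicial {d : ℕ} (P : Set (Fin d → ℝ)) : Prop :=
  ∀ F, IsFacet P F → (Set.extremePoints ℝ F).ncard = d

/-- Smooth: the vertices of every facet form a `ℤ`-basis of the lattice. -/
def IsSmoothPolytope {d : ℕ} (P : Set (Fin d → ℝ)) : Prop :=
  ∀ F, IsFacet P F → ∃ s : Fin d → (Fin d → ℝ),
    Set.extremePoints ℝ F = Set.range s ∧ IsZBasisFamily s

/-- Semi-terminal: any two distinct vertices in a common facet are joined by a lattice-point
free segment. -/
def IsSemiTerminal {d : ℕ} (P : Set (Fin d → ℝ)) : Prop :=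
  ∀ v ∈ Set.extremePoints ℝ P, ∀ w ∈ Set.extremePoints ℝ P, v ≠ w → SameFacet P v w →
    {x ∈ segment ℝ v w | IsLatticePoint x} = {v, w}

/-- The quotient space `ℝ^d / ℝv`. -/
abbrev QuotSpace {d : ℕ} (v : Fin d → ℝ) := (Fin d → ℝ) ⧸ (Submodule.span ℝ {v})

/-- The canonical projection `π_v : ℝ^d → ℝ^d/ℝv`. -/
def projAlong {d : ℕ} (v : Fin d → ℝ) : (Fin d → ℝ) →ₗ[ℝ] QuotSpace v :=
  (Submodule.span ℝ {v}).mkQ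

/-- The quotient lattice `ℤ^d/ℤv`, regarded as the image of `ℤ^d` in `ℝ^d/ℝv`. -/
def quotLattice {d : ℕ} (v : Fin d → ℝ) : Set (QuotSpace v) :=
  projAlong v '' {x | IsLatticePoint x}

/-- A primitive point of the quotient lattice `ℤ^d/ℤv`. -/
def QuotPrimitive {d : ℕ} (v : Fin d → ℝ) (q : QuotSpace v) : Prop :=
  q ∈ quotLattice v ∧ q ≠ 0 ∧ ∀ t ∈ openSegment ℝ (0 : QuotSpace v) q, t ∉ quotLattice v

/-- A Fano polytope in the quotient space `ℝ^d/ℝv` with respect to the lattice `ℤ^d/ℤv`. -/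
def QuotIsFanoPolytope {d : ℕ} (v : Fin d → ℝ) (Q : Set (QuotSpace v)) : Prop :=
  (∃ V : Finset (QuotSpace v), (∀ q ∈ V, q ∈ quotLattice v) ∧
      Q = convexHull ℝ (V : Set (QuotSpace v))) ∧
  (0 : QuotSpace v) ∈ interior Q ∧
  ∀ q ∈ Set.extremePoints ℝ Q, QuotPrimitive v q

/-- Unimodular equivalence: a real linear isomorphism mapping lattice onto lattice and one
polytope onto the other. -/
def LatticeEquivTo {d e : ℕ} (P : Set (Fin d → ℝ)) (Q : Set (Fin e → ℝ)) : Prop :=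
  ∃ f : (Fin d → ℝ) ≃ₗ[ℝ] (Fin e → ℝ),
    (∀ x, IsLatticePoint x ↔ IsLatticePoint (f x)) ∧ f '' P = Q

/-- The hexagon `Z₂ = conv(±(1,0), ±(0,1), ±(1,1)) ⊆ ℝ²`. -/
def Z2 : Set (Fin 2 → ℝ) :=
  convexHull ℝ ({![1,0], ![0,1], ![1,1], ![-1,0], ![0,-1], ![-1,-1]} : Set (Fin 2 → ℝ))

/-- The `j`-th coordinate pair of a point of `ℝ^{2m}`. -/
def pairCoords {m : ℕ} (x : Fin (2 * m) → ℝ) (j : Fin m) : Fin 2 → ℝ :=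
  fun i => x ⟨2 * (j : ℕ) + (i : ℕ), by have := j.isLt; have := i.isLt; omega⟩

/-- The `m`-fold product `Z₂ × ⋯ × Z₂ ⊆ ℝ^{2m}`. -/
def prodZ2 (m : ℕ) : Set (Fin (2 * m) → ℝ) := {x | ∀ j : Fin m, pairCoords x j ∈ Z2}

/-- The `j`-th coordinate pair of a point of `ℝ^{2m+1}` (first `2m` coordinates). -/
def pairCoords' {m : ℕ} (x : Fin (2 * m + 1) → ℝ) (j : Fin m) : Fin 2 → ℝ :=
  fun i => x ⟨2 * (j : ℕ) + (i : ℕ), by have := j.isLt; have := i.isLt; omega⟩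

/-- The product `[-1,1] × Z₂ × ⋯ × Z₂ ⊆ ℝ^{2m+1}` with `m` hexagon factors. -/
def boxProdZ2 (m : ℕ) : Set (Fin (2 * m + 1) → ℝ) :=
  {x | x ⟨2 * m, by omega⟩ ∈ Set.Icc (-1 : ℝ) 1 ∧ ∀ j : Fin m, pairCoords' x j ∈ Z2}

lemma dotProd_eq_dotProduct {d : ℕ} (x y : Fin d → ℝ) : dotProd x y = x ⬝ᵥ y := rfl

/-- Points on a line `⟨x, u⟩ = c` of the plane are collinear. -/
lemma collinear_of_dotProduct_eq {u : Fin 2 → ℝ} (hu : u ≠ 0) {c : ℝ} {S : Set (Fin 2 → ℝ)}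
    (hS : ∀ x ∈ S, x ⬝ᵥ u = c) : Collinear ℝ S := by
  rcases S.eq_empty_or_nonempty with rfl | ⟨p, hp⟩
  · exact collinear_empty ℝ _
  have hpos : u 0 ^ 2 + u 1 ^ 2 ≠ 0 := by
    intro h
    rw [sq, sq] at h
    refine hu (funext fun i => ?_)
    fin_cases i
    · exact (mul_self_add_mul_self_eq_zero.mp h).1
    · exact (mul_self_add_mul_self_eq_zero.mp h).2
  refine (collinear_iff_of_mem hp).2 ⟨![-u 1, u 0], fun x hx => ?_⟩
  refine ⟨((x 1 - p 1) * u 0 - (x 0 - p 0) * u 1) / (u 0 ^ 2 + u 1 ^ 2), ?_⟩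
  have hxp : x 0 * u 0 + x 1 * u 1 = p 0 * u 0 + p 1 * u 1 := by
    simpa [dotProduct, Fin.sum_univ_two] using (hS x hx).trans (hS p hp).symm
  ext i
  fin_cases i
  · simp only [Fin.zero_eta, vadd_eq_add, Pi.add_apply, Pi.smul_apply, smul_eq_mul,
      Matrix.cons_val_zero]
    field_simp
    linear_combination u 0 * hxp
  · simp only [Fin.mk_one, vadd_eq_add, Pi.add_apply, Pi.smul_apply, smul_eq_mul,
      Matrix.cons_val_one, Matrix.cons_val_fin_one]
    field_simp
    linear_combination u 1 * hxp

/-- An extreme point of `P` is not strictly between two points of `P`. -/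
lemma not_sbtw_of_mem_extremePoints {E : Type*} [AddCommGroup E] [Module ℝ E] {P : Set E}
    {a b c : E} (ha : a ∈ P) (hb : b ∈ Set.extremePoints ℝ P) (hc : c ∈ P) : ¬ Sbtw ℝ a b c := by
  intro h
  have hb' : b ∈ openSegment ℝ a c := by
    rw [openSegment_eq_image_lineMap]
    exact (sbtw_iff_mem_image_Ioo_and_ne.mp h).1
  exact h.left_ne (mem_extremePoints.mp hb |>.2 a ha c hc hb').1

/-- A collinear set of extreme points has at most two elements. -/
lemma card_le_two_of_collinear_of_subset_extremePoints {E : Type*} [AddCommGroup E] [Module ℝ E]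
    {P : Set E} {S : Finset E} (hS : (S : Set E) ⊆ Set.extremePoints ℝ P)
    (hcol : Collinear ℝ (S : Set E)) : S.card ≤ 2 := by
  by_contra! h
  obtain ⟨a, ha, b, hb, c, hc, hab, hac, hbc⟩ := Finset.two_lt_card.mp h
  have hsub : ({a, b, c} : Set E) ⊆ S := by
    rintro x (rfl | rfl | rfl) <;> assumption
  have ha := hS ha
  have hb := hS hb
  have hc := hS hc
  rcases (hcol.subset hsub).wbtw_or_wbtw_or_wbtw with h | h | h
  · exact not_sbtw_of_mem_extremePoints ha.1 hb hc.1 ⟨h, hab.symm, hbc⟩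
  · exact not_sbtw_of_mem_extremePoints hb.1 hc ha.1 ⟨h, hbc.symm, hac.symm⟩
  · exact not_sbtw_of_mem_extremePoints hc.1 ha hb.1 ⟨h, hac, hab⟩

/-- The dual of a bounded set contains points with negative product with any given `w ≠ 0`. -/
lemma exists_mem_dualPolytope_dotProduct_neg {d : ℕ} {P : Set (Fin d → ℝ)} (hP : IsCompact P)
    {w : Fin d → ℝ} (hw : w ≠ 0) : ∃ y ∈ dualPolytope P, y ⬝ᵥ w < 0 := by
  obtain ⟨M, hM⟩ := hP.exists_bound_of_continuousOn (f := fun x => x ⬝ᵥ w)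
    (by fun_prop)
  have hpos : 0 < |M| + 1 := by positivity
  refine ⟨-((|M| + 1)⁻¹ • w), fun x hx => ?_, ?_⟩
  · have h1 : x ⬝ᵥ w ≤ |M| + 1 :=
      ((le_abs_self _).trans (hM x hx)).trans ((le_abs_self M).trans (by linarith))
    rw [dotProd_eq_dotProduct, dotProduct_neg, dotProduct_smul, smul_eq_mul, neg_le_neg_iff,
      inv_mul_le_iff₀ hpos]
    simpa using h1
  · rw [neg_dotProduct, smul_dotProduct, smul_eq_mul, neg_lt_zero]
    have : 0 < w ⬝ᵥ w := lt_of_le_of_ne (Finset.sum_nonneg fun i _ => mul_self_nonneg (w i))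
      (Ne.symm (by simpa using hw))
    positivity

/-- A linear functional that is negative somewhere on a convex hull is negative at a generator. -/
lemma exists_dotProduct_neg_of_mem_convexHull {d : ℕ} {U : Set (Fin d → ℝ)} {y w : Fin d → ℝ}
    (hy : y ∈ convexHull ℝ U) (hyw : y ⬝ᵥ w < 0) : ∃ u ∈ U, u ⬝ᵥ w < 0 := by
  by_contra! h
  have hconv : Convex ℝ {x : Fin d → ℝ | 0 ≤ x ⬝ᵥ w} :=
    convex_halfSpace_ge ⟨fun a b => add_dotProduct a b w, fun r a => smul_dotProduct r a w⟩ 0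
  exact hyw.not_ge (convexHull_min (fun u hu => h u hu) hconv hy)

lemma IsLatticePoint.exists_dotProduct_eq_intCast {d : ℕ} {x y : Fin d → ℝ}
    (hx : IsLatticePoint x) (hy : IsLatticePoint y) : ∃ n : ℤ, x ⬝ᵥ y = n := by
  choose a ha using hx
  choose b hb using hy
  exact ⟨∑ i, a i * b i, by simp [dotProduct, ha, hb]⟩

/-- For every `s`, some nonzero lattice point of the dual has nonpositive product with `s`. -/
lemma exists_ne_zero_mem_dualPolytope_dotProduct_nonpos {d : ℕ} [NeZero d] {P : Set (Fin d → ℝ)}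
    (hP : IsCompact P) (hdual : IsLatticePolytope (dualPolytope P)) (s : Fin d → ℝ) :
    ∃ u ∈ dualPolytope P, IsLatticePoint u ∧ u ≠ 0 ∧ s ⬝ᵥ u ≤ 0 := by
  obtain ⟨U, hU, hPU⟩ := hdual
  obtain ⟨w, hw, hsw⟩ : ∃ w : Fin d → ℝ, w ≠ 0 ∧ ∀ u, u ⬝ᵥ w < 0 → s ⬝ᵥ u ≤ 0 := by
    by_cases hs : s = 0
    · exact ⟨1, one_ne_zero, fun u _ => by simp [hs]⟩
    · exact ⟨s, hs, fun u hu => by rw [dotProduct_comm]; exact hu.le⟩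
  obtain ⟨y, hy, hyw⟩ := exists_mem_dualPolytope_dotProduct_neg hP hw
  obtain ⟨u, hu, huw⟩ := exists_dotProduct_neg_of_mem_convexHull (hPU ▸ hy) hyw
  refine ⟨u, hPU ▸ subset_convexHull ℝ _ hu, hU u hu, ?_, hsw u huw⟩
  rintro rfl
  simp at huw

/-- Every two-dimensional reflexive polytope has at most six vertices. -/
theorem two_dim_reflexive_vertices_le_six (P : Set (Fin 2 → ℝ)) (hP : IsReflexive P) :
    (Set.extremePoints ℝ P).ncard ≤ 6 := by
  classical
  obtain ⟨⟨V, hV, hPV⟩, -, hdual⟩ := hP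
  have hsub : Set.extremePoints ℝ P ⊆ V := hPV ▸ extremePoints_convexHull_subset
  obtain ⟨E, hE⟩ := (V.finite_toSet.subset hsub).exists_finset_coe
  have hcomp : IsCompact P := hPV ▸ V.finite_toSet.isCompact_convexHull (𝕜 := ℝ)
  obtain ⟨u, hu, hulat, hu0, hsum⟩ :=
    exists_ne_zero_mem_dualPolytope_dotProduct_nonpos hcomp hdual (∑ v ∈ E, v)
  rw [sum_dotProduct] at hsum
  have hline (c : ℝ) : (E.filter fun v => v ⬝ᵥ u = c).card ≤ 2 := by
    refine card_le_two_of_collinear_of_subset_extremePoints (P := P) ?_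
      (collinear_of_dotProduct_eq hu0 (c := c) ?_)
    · rw [← hE]
      exact Finset.coe_subset.mpr (Finset.filter_subset _ _)
    · intro x hx
      exact (Finset.mem_filter.mp hx).2
  have hpt : ∀ v ∈ E, (1 : ℝ) ≤ v ⬝ᵥ u + 2 * (if v ⬝ᵥ u = -1 then 1 else 0)
      + (if v ⬝ᵥ u = 0 then 1 else 0) := by
    intro v hv
    have hvP : v ∈ Set.extremePoints ℝ P := hE ▸ hv
    obtain ⟨n, hn⟩ := (hV v (hsub hvP)).exists_dotProduct_eq_intCast hulat
    have hge : -1 ≤ v ⬝ᵥ u := hu v hvP.1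
    rw [hn] at hge ⊢
    norm_cast at hge ⊢
    split_ifs <;> omega
  have h := Finset.sum_le_sum hpt
  rw [Finset.sum_add_distrib, Finset.sum_add_distrib, ← Finset.mul_sum, Finset.sum_boole,
    Finset.sum_boole, Finset.sum_const, nsmul_one] at h
  have h1 : ((E.filter fun v => v ⬝ᵥ u = -1).card : ℝ) ≤ 2 := by exact_mod_cast hline (-1)
  have h0 : ((E.filter fun v => v ⬝ᵥ u = 0).card : ℝ) ≤ 2 := by exact_mod_cast hline 0
  rw [← hE, Set.ncard_coe_finset]
  have : (E.card : ℝ) ≤ 6 := by linarith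
  exact_mod_cast this

end
end

section
/- There are exactly 16 two-dimensional reflexive polytopes up to isomorphism, i.e., the set of equivalence classes of two-dimensional reflexive polytopes in ℝ² under the action of GL₂(ℤ) has exactly 16 elements. -/
open scoped BigOperators

noncomputable section

/-- The point of `ℝ²` with given integer coordinates. -/
def pt (p : ℤ × ℤ) : Fin 2 → ℝ := ![(p.1 : ℝ), (p.2 : ℝ)]

/-- The convex hull in `ℝ²` of a set of integer vectors. -/
def hull (T : Set (ℤ × ℤ)) : Set (Fin 2 → ℝ) := convexHull ℝ (pt '' T)

/-- The standard pairing on `ℤ²`. -/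
def pairing (p q : ℤ × ℤ) : ℤ := p.1 * q.1 + p.2 * q.2

/-- The determinant of two vectors in `ℤ²`. -/
def cross (p q : ℤ × ℤ) : ℤ := p.1 * q.2 - p.2 * q.1

/-- The matrix with columns `a` and `b` applied to a vector. -/
def act (a b p : ℤ × ℤ) : ℤ × ℤ := (p.1 * a.1 + p.2 * b.1, p.1 * a.2 + p.2 * b.2)

/-- The half-plane intersection `⟨w, p⟩ ≥ -1`, `w ∈ W`, on lattice points. -/
abbrev InDual (W : List (ℤ × ℤ)) (p : ℤ × ℤ) : Prop := ∀ w ∈ W, -1 ≤ pairing w p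

/-- `T` is contained in no closed half-plane, tested against lattice directions. -/
def PosSpanning (T : Set (ℤ × ℤ)) : Prop := ∀ u : ℤ × ℤ, u ≠ 0 → ∃ t ∈ T, pairing u t < 0

/-- Every `w ∈ W` supports an edge through two vectors `v, v'` of `V`, and both ends of the edge
are shared with other members of `W`. -/
abbrev FacetCertificate (V W : List (ℤ × ℤ)) : Prop :=
  V ≠ [] ∧ W ≠ [] ∧ ∀ w ∈ W, ∃ v ∈ V, ∃ v' ∈ V, cross v v' ≠ 0 ∧
    pairing w v = -1 ∧ pairing w v' = -1 ∧
    (∃ x ∈ W, pairing x v = -1 ∧ -1 < pairing x v') ∧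
    (∃ x ∈ W, pairing x v' = -1 ∧ -1 < pairing x v)

/-! ### Lattice points and hulls -/

lemma dotProd_pt_left (p : ℤ × ℤ) (y : Fin 2 → ℝ) :
    dotProd (pt p) y = p.1 * y 0 + p.2 * y 1 := by
  simp [dotProd, pt, Fin.sum_univ_two]

lemma dotProd_pt (p q : ℤ × ℤ) : dotProd (pt p) (pt q) = pairing p q := by
  simp [dotProd, pt, pairing, Fin.sum_univ_two]

lemma dotProd_swap (x y : Fin 2 → ℝ) : dotProd x y = dotProd y x := by
  simp [dotProd, mul_comm]

lemma pt_injective : Function.Injective pt := by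
  intro p q h
  have h0 := congrFun h 0
  have h1 := congrFun h 1
  simp [pt] at h0 h1
  exact Prod.ext h0 h1

lemma isLatticePoint_pt (p : ℤ × ℤ) : IsLatticePoint (pt p) := by
  intro i
  fin_cases i
  exacts [⟨p.1, rfl⟩, ⟨p.2, rfl⟩]

lemma exists_pt_of_isLatticePoint {x : Fin 2 → ℝ} (h : IsLatticePoint x) : ∃ p, pt p = x := by
  obtain ⟨m, hm⟩ := h 0
  obtain ⟨n, hn⟩ := h 1
  refine ⟨(m, n), ?_⟩
  ext i
  fin_cases i
  exacts [hm.symm, hn.symm]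

lemma isLatticePolytope_iff_hull (P : Set (Fin 2 → ℝ)) :
    IsLatticePolytope P ↔ ∃ T : Set (ℤ × ℤ), T.Finite ∧ P = hull T := by
  constructor
  · rintro ⟨V, hV, rfl⟩
    refine ⟨pt ⁻¹' V, V.finite_toSet.preimage pt_injective.injOn, ?_⟩
    rw [hull, Set.image_preimage_eq_of_subset]
    intro x hx
    exact exists_pt_of_isLatticePoint (hV x hx)
  · rintro ⟨T, hT, rfl⟩
    refine ⟨(hT.image pt).toFinset, ?_, by simp [hull]⟩
    intro v hv
    obtain ⟨p, -, rfl⟩ := (Set.Finite.mem_toFinset _).1 hv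
    exact isLatticePoint_pt p

lemma pt_mem_hull {T : Set (ℤ × ℤ)} {p : ℤ × ℤ} (h : p ∈ T) : pt p ∈ hull T :=
  subset_convexHull ℝ _ ⟨p, h, rfl⟩

lemma convex_dotProd_ge (y : Fin 2 → ℝ) (c : ℝ) : Convex ℝ {x | c ≤ dotProd x y} := by
  intro x hx z hz a b ha hb hab
  simp only [Set.mem_ofPred_eq, dotProd, Fin.sum_univ_two, Pi.add_apply, Pi.smul_apply,
    smul_eq_mul] at *
  calc c = a * c + b * c := by rw [← add_mul, hab, one_mul]
    _ ≤ _ := add_le_add (mul_le_mul_of_nonneg_left hx ha) (mul_le_mul_of_nonneg_left hz hb)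
    _ = _ := by ring

lemma le_dotProd_of_mem_hull {T : Set (ℤ × ℤ)} {x y : Fin 2 → ℝ} {c : ℝ}
    (h : ∀ t ∈ T, c ≤ dotProd (pt t) y)
    (hx : x ∈ hull T) : c ≤ dotProd x y := by
  refine (convexHull_min ?_ (convex_dotProd_ge y c) : hull T ⊆ _) hx
  rintro _ ⟨t, ht, rfl⟩
  exact h t ht

lemma mem_dualPolytope_hull {T : Set (ℤ × ℤ)} {y : Fin 2 → ℝ} :
    y ∈ dualPolytope (hull T) ↔ ∀ t ∈ T, -1 ≤ dotProd (pt t) y :=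
  ⟨fun h _ ht => h _ (pt_mem_hull ht), fun h _ hx => le_dotProd_of_mem_hull h hx⟩

lemma convex_dualPolytope (P : Set (Fin 2 → ℝ)) : Convex ℝ (dualPolytope P) := by
  intro x hx z hz a b ha hb hab p hp
  have hx' := hx p hp
  have hz' := hz p hp
  rw [dotProd_swap] at hx' hz' ⊢
  exact convex_dotProd_ge p (-1) hx' hz' ha hb hab

lemma smul_add_smul_mem_of_zero_mem {P : Set (Fin 2 → ℝ)} (hP : Convex ℝ P) (h0 : 0 ∈ P)
    {x y : Fin 2 → ℝ} (hx : x ∈ P) (hy : y ∈ P) {s t : ℝ} (hs : 0 ≤ s) (ht : 0 ≤ t)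
    (hst : s + t ≤ 1) : s • x + t • y ∈ P := by
  have hmem := hP.sum_mem (t := Finset.univ) (w := ![1 - s - t, s, t]) (z := ![0, x, y])
    (by
      intro i _
      fin_cases i <;> simp <;> linarith)
    (by simp [Fin.sum_univ_three]; ring)
    (by
      intro i _
      fin_cases i
      exacts [h0, hx, hy])
  simpa [Fin.sum_univ_three] using hmem

/-! ### Hulls as half-plane intersections -/

section FacetCertificate

variable {V W : List (ℤ × ℤ)}

lemma FacetCertificate.exists_cone (h : FacetCertificate V W) (y : Fin 2 → ℝ) :
    ∃ w ∈ W, ∃ v ∈ V, ∃ v' ∈ V, ∃ s t : ℝ, 0 ≤ s ∧ 0 ≤ t ∧ y = s • pt v + t • pt v' ∧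
      dotProd (pt w) y = -(s + t) := by
  obtain ⟨-, hW, h⟩ := h
  obtain ⟨w, hw, hmin⟩ := W.toFinset.exists_min_image (fun w => dotProd (pt w) y)
    (List.toFinset_nonempty_iff W |>.2 hW)
  rw [List.mem_toFinset] at hw
  obtain ⟨v, hv, v', hv', hc, h1, h2, ⟨x, hx, h3, h4⟩, ⟨z, hz, h5, h6⟩⟩ := h w hw
  have hxm := hmin x (by simpa using hx)
  have hzm := hmin z (by simpa using hz)
  have hc' : (cross v v' : ℝ) ≠ 0 := by exact_mod_cast hc
  obtain ⟨s, hs⟩ : ∃ s : ℝ, s * cross v v' = y 0 * v'.2 - y 1 * v'.1 := ⟨_, div_mul_cancel₀ _ hc'⟩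
  obtain ⟨t, ht⟩ : ∃ t : ℝ, t * cross v v' = v.1 * y 1 - v.2 * y 0 := ⟨_, div_mul_cancel₀ _ hc'⟩
  have hy0 : y 0 = s * v.1 + t * v'.1 := by
    apply mul_right_cancel₀ hc'
    linear_combination (norm := (simp only [cross]; push_cast; ring)) -v.1 * hs - v'.1 * ht
  have hy1 : y 1 = s * v.2 + t * v'.2 := by
    apply mul_right_cancel₀ hc'
    linear_combination (norm := (simp only [cross]; push_cast; ring)) -v.2 * hs - v'.2 * ht
  have key (u : ℤ × ℤ) : dotProd (pt u) y = s * pairing u v + t * pairing u v' := by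
    rw [dotProd_pt_left, hy0, hy1]
    simp only [pairing]
    push_cast
    ring
  rw [key, key] at hxm hzm
  have h4' : (0 : ℝ) < pairing x v' + 1 := by exact_mod_cast (by omega : 0 < pairing x v' + 1)
  have h6' : (0 : ℝ) < pairing z v + 1 := by exact_mod_cast (by omega : 0 < pairing z v + 1)
  simp only [h1, h2, h3, h5] at hxm hzm
  push_cast at hxm hzm
  refine ⟨w, hw, v, hv, v', hv', s, t, ?_, ?_, ?_, ?_⟩
  · exact nonneg_of_mul_nonneg_left (by linarith : 0 ≤ s * (pairing z v + 1)) h6'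
  · exact nonneg_of_mul_nonneg_left (by linarith : 0 ≤ t * (pairing x v' + 1)) h4'
  · ext i
    fin_cases i
    · simpa [pt] using hy0
    · simpa [pt] using hy1
  · rw [key, h1, h2]
    push_cast
    ring

lemma FacetCertificate.zero_mem_hull (h : FacetCertificate V W) : 0 ∈ hull {p | p ∈ V} := by
  obtain ⟨v₀, hv₀⟩ := List.exists_mem_of_ne_nil V h.1
  obtain ⟨-, -, v, hv, v', hv', s, t, hs, ht, hy, -⟩ := h.exists_cone (-pt v₀)
  have hpos : 0 < 1 + s + t := by linarith
  have hconv : Convex ℝ (hull {p | p ∈ V}) := convex_convexHull ℝ _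
  have hmem := hconv.sum_mem (t := Finset.univ) (w := ![1 / (1 + s + t), s / (1 + s + t),
    t / (1 + s + t)]) (z := ![pt v₀, pt v, pt v']) (by
      intro i _
      fin_cases i <;> simp <;> positivity)
    (by simp [Fin.sum_univ_three]; field_simp)
    (by
      intro i _
      fin_cases i
      exacts [pt_mem_hull hv₀, pt_mem_hull hv, pt_mem_hull hv'])
  convert hmem using 1
  have : (0 : Fin 2 → ℝ) = (1 / (1 + s + t)) • (pt v₀ + (s • pt v + t • pt v')) := by
    rw [← hy]; simp
  rw [this, Fin.sum_univ_three]
  simp [smul_smul, smul_add, div_eq_inv_mul, add_assoc]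

lemma FacetCertificate.hull_eq (h : FacetCertificate V W)
    (hVW : ∀ v ∈ V, InDual W v) :
    hull {p | p ∈ V} = {y | ∀ w ∈ W, -1 ≤ dotProd (pt w) y} := by
  apply Set.Subset.antisymm
  · intro y hy w hw
    rw [dotProd_swap]
    refine le_dotProd_of_mem_hull ?_ hy
    intro v hv
    rw [dotProd_swap, dotProd_pt]
    exact_mod_cast hVW v hv w hw
  · intro y hy
    obtain ⟨w, hw, v, hv, v', hv', s, t, hs, ht, hyst, hwy⟩ := h.exists_cone y
    have hst := hy w hw
    rw [hwy] at hst
    rw [hyst]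
    exact smul_add_smul_mem_of_zero_mem (convex_convexHull ℝ _) h.zero_mem_hull
      (pt_mem_hull hv) (pt_mem_hull hv') hs ht (by linarith)

lemma FacetCertificate.zero_mem_interior (h : FacetCertificate V W)
    (hVW : ∀ v ∈ V, InDual W v) : 0 ∈ interior (hull {p | p ∈ V}) := by
  rw [h.hull_eq hVW, mem_interior]
  refine ⟨⋂ w ∈ {w | w ∈ W}, {y | -1 < dotProd (pt w) y}, ?_, ?_, ?_⟩
  · intro y hy w hw
    simp only [Set.mem_iInter] at hy
    exact (hy w hw).le
  · refine Set.Finite.isOpen_biInter (List.finite_toSet W) fun w _ => ?_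
    simp only [dotProd]
    exact isOpen_lt (by fun_prop) (by fun_prop)
  · simp [dotProd]

lemma FacetCertificate.isReflexive (h : FacetCertificate V W) (h' : FacetCertificate W V)
    (hVW : ∀ v ∈ V, InDual W v) : IsReflexive (hull {p | p ∈ V}) := by
  have hWV : ∀ w ∈ W, InDual V w := by
    intro w hw v hv
    simpa [pairing, mul_comm] using hVW v hv w hw
  refine ⟨(isLatticePolytope_iff_hull _).2 ⟨_, List.finite_toSet V, rfl⟩,
    h.zero_mem_interior hVW, (isLatticePolytope_iff_hull _).2 ⟨_, List.finite_toSet W, ?_⟩⟩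
  rw [h'.hull_eq hWV]
  ext y
  exact mem_dualPolytope_hull

lemma FacetCertificate.pt_mem_hull_iff (h : FacetCertificate V W)
    (hVW : ∀ v ∈ V, InDual W v) (p : ℤ × ℤ) : pt p ∈ hull {p | p ∈ V} ↔ InDual W p := by
  rw [h.hull_eq hVW]
  refine forall₂_congr fun w _ => ?_
  rw [dotProd_pt]
  norm_cast

end FacetCertificate

/-! ### Unimodular maps -/

lemma pairing_act (a b p q : ℤ × ℤ) :
    pairing p (act a b q) = pairing (pairing p a, pairing p b) q := by
  simp only [pairing, act]
  ring

lemma LatticeEquivTo.refl (P : Set (Fin 2 → ℝ)) : LatticeEquivTo P P :=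
  ⟨LinearEquiv.refl ℝ _, fun _ => Iff.rfl, Set.image_id P⟩

lemma LatticeEquivTo.trans {P Q R : Set (Fin 2 → ℝ)} :
    LatticeEquivTo P Q → LatticeEquivTo Q R → LatticeEquivTo P R := by
  rintro ⟨f, hf, rfl⟩ ⟨g, hg, rfl⟩
  exact ⟨f.trans g, fun x => (hf x).trans (hg (f x)), (Set.image_image g f P).symm⟩

/-- The linear map of `ℝ²` with integer columns `a` and `b`. -/
def actReal (a b : ℤ × ℤ) : (Fin 2 → ℝ) →ₗ[ℝ] (Fin 2 → ℝ) where
  toFun x := x 0 • pt a + x 1 • pt b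
  map_add' x y := by simp only [Pi.add_apply]; module
  map_smul' c x := by simp only [Pi.smul_apply, smul_eq_mul, RingHom.id_apply]; module

lemma actReal_pt (a b p : ℤ × ℤ) : actReal a b (pt p) = pt (act a b p) := by
  ext i
  fin_cases i <;> simp [actReal, pt, act]

lemma latticeEquivTo_hull_act {a b : ℤ × ℤ} (h : cross a b * cross a b = 1) (T : Set (ℤ × ℤ)) :
    LatticeEquivTo (hull T) (hull (act a b '' T)) := by
  set a' : ℤ × ℤ := (cross a b * b.2, -(cross a b * a.2)) with ha'
  set b' : ℤ × ℤ := (-(cross a b * b.1), cross a b * a.1) with hb'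
  have h₁ (x : Fin 2 → ℝ) : actReal a' b' (actReal a b x) = x := by
    have h' : (cross a b * cross a b : ℝ) = 1 := by exact_mod_cast h
    ext i
    fin_cases i
    · simp [actReal, pt, ha', hb']
      linear_combination (norm := (simp only [cross]; push_cast; ring)) x 0 * h'
    · simp [actReal, pt, ha', hb']
      linear_combination (norm := (simp only [cross]; push_cast; ring)) x 1 * h'
  have h₂ (x : Fin 2 → ℝ) : actReal a b (actReal a' b' x) = x := by
    have h' : (cross a b * cross a b : ℝ) = 1 := by exact_mod_cast h
    ext i
    fin_cases i
    · simp [actReal, pt, ha', hb']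
      linear_combination (norm := (simp only [cross]; push_cast; ring)) x 0 * h'
    · simp [actReal, pt, ha', hb']
      linear_combination (norm := (simp only [cross]; push_cast; ring)) x 1 * h'
  refine ⟨LinearEquiv.ofLinearMap (actReal a b) (actReal a' b') (LinearMap.ext h₂)
    (LinearMap.ext h₁), fun x => ⟨fun hx => ?_, fun hx => ?_⟩, ?_⟩
  · obtain ⟨p, rfl⟩ := exists_pt_of_isLatticePoint hx
    rw [LinearEquiv.coe_ofLinearMap, actReal_pt]
    exact isLatticePoint_pt _
  · obtain ⟨p, hp⟩ := exists_pt_of_isLatticePoint hx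
    rw [LinearEquiv.coe_ofLinearMap] at hp
    rw [← h₁ x, ← hp, actReal_pt]
    exact isLatticePoint_pt _
  · rw [hull, hull, Set.image_image, Set.image_congr (fun p _ => (actReal_pt a b p).symm)]
    rw [← Set.image_image (actReal a b) pt, ← LinearMap.image_convexHull]
    rfl

lemma PosSpanning.image_act {a b : ℤ × ℤ} (h : cross a b * cross a b = 1) {T : Set (ℤ × ℤ)}
    (hT : PosSpanning T) : PosSpanning (act a b '' T) := by
  intro u hu
  have : ((pairing u a, pairing u b) : ℤ × ℤ) ≠ 0 := by
    intro h0
    rw [Prod.mk_eq_zero] at h0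
    apply hu
    ext
    · linear_combination (norm := (simp only [cross, pairing, Prod.fst_zero]; ring))
        -u.1 * h + cross a b * (b.2 * h0.1 - a.2 * h0.2)
    · linear_combination (norm := (simp only [cross, pairing, Prod.snd_zero]; ring))
        -u.2 * h + cross a b * (a.1 * h0.2 - b.1 * h0.1)
  obtain ⟨t, ht, hlt⟩ := hT _ this
  exact ⟨_, ⟨t, ht, rfl⟩, by rwa [pairing_act]⟩

/-! ### Three minimal configurations -/

/-- The vertex sets of the three minimal lattice polygons whose only interior lattice point
is `0`. -/
def minimalPolygons : List (List (ℤ × ℤ)) :=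
  [[(1, 0), (0, 1), (-1, -1)], [(1, 0), (0, 1), (-1, 0), (0, -1)], [(1, -1), (-1, -1), (0, 1)]]

/-- Closure of `S` under taking lattice points of triangles with apex `0`. -/
def TriangleClosed (S : Set (ℤ × ℤ)) : Prop :=
  ∀ a ∈ S, ∀ b ∈ S, ∀ d : ℤ × ℤ, ∀ k p q : ℤ, 0 < k → 0 ≤ p → 0 ≤ q → p + q ≤ k →
    k • d = p • a + q • b → d ∈ S

/-- Every nonzero point of `S` lies on a supporting line `⟨w, ·⟩ = -1` of `S` with `w` integral. -/
def HasIntegralSupports (S : Set (ℤ × ℤ)) : Prop :=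
  ∀ p ∈ S, p ≠ 0 → ∃ w : ℤ × ℤ, pairing w p = -1 ∧ ∀ q ∈ S, -1 ≤ pairing w q

lemma ne_zero_left_of_cross_pos {a b : ℤ × ℤ} (h : 0 < cross a b) : a ≠ 0 := by
  rintro rfl
  simp [cross] at h

lemma ne_zero_right_of_cross_pos {a b : ℤ × ℤ} (h : 0 < cross a b) : b ≠ 0 := by
  rintro rfl
  simp [cross] at h

section Lattice

variable {S : Set (ℤ × ℤ)}

/-- Between `a` and `b` there is a lattice point of the triangle `0ab` completing `a` to a basis. -/
lemma exists_basis_completion (hS : TriangleClosed S) (hw : HasIntegralSupports S)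
    {a b : ℤ × ℤ} (ha : a ∈ S) (hb : b ∈ S) (hab : 0 < cross a b) :
    ∃ d ∈ S, cross a d = 1 ∧ ∃ s : ℤ, 0 ≤ s ∧ s < cross a b ∧ cross a b • d = s • a + b := by
  obtain ⟨w, hwa, -⟩ := hw a ha (ne_zero_left_of_cross_pos hab)
  set e : ℤ × ℤ := (w.2, -w.1) with he
  have hae : cross a e = 1 := by
    simp only [cross, pairing, he] at *
    linarith
  set D := cross a b with hD
  set s := (-cross b e) % D with hs
  have hs0 : 0 ≤ s := Int.emod_nonneg _ hab.ne'
  have hsD : s < D := Int.emod_lt_of_pos _ hab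
  obtain ⟨j, hj⟩ : ∃ j, s = D * j - cross b e := by
    refine ⟨-(-cross b e / D), ?_⟩
    have := Int.emod_add_mul_ediv (-cross b e) D
    linear_combination this
  have hd : D • (e + j • a) = s • a + b := by
    rw [hj]
    ext
    · simp only [Prod.smul_fst, Prod.fst_add, smul_eq_mul]
      linear_combination (norm := (simp only [hD, cross]; ring)) b.1 * hae
    · simp only [Prod.smul_snd, Prod.snd_add, smul_eq_mul]
      linear_combination (norm := (simp only [hD, cross]; ring)) b.2 * hae
  refine ⟨e + j • a, hS a ha b hb _ D s 1 hab hs0 zero_le_one (by omega) (by simpa using hd),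
    ?_, s, hs0, hsD, hd⟩
  rw [← hae]
  simp only [cross, Prod.fst_add, Prod.snd_add, Prod.smul_fst, Prod.smul_snd, smul_eq_mul]
  ring

lemma eq_or_eq_neg_of_cross_eq_zero (hw : HasIntegralSupports S) {a b : ℤ × ℤ} (ha : a ∈ S)
    (hb : b ∈ S) (ha0 : a ≠ 0) (hb0 : b ≠ 0) (hab : cross a b = 0) : b = a ∨ b = -a := by
  obtain ⟨w, hwa, -⟩ := hw a ha ha0
  obtain ⟨z, hzb, -⟩ := hw b hb hb0
  have h1 : b.1 = -pairing w b * a.1 := by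
    simp only [pairing, cross] at *
    linear_combination b.1 * hwa + w.2 * hab
  have h2 : b.2 = -pairing w b * a.2 := by
    simp only [pairing, cross] at *
    linear_combination b.2 * hwa - w.1 * hab
  have h3 : pairing w b * pairing z a = 1 := by
    have : pairing z b = -pairing w b * pairing z a := by
      conv_lhs => rw [pairing, h1, h2]
      simp only [pairing]
      ring
    linarith
  rcases Int.eq_one_or_neg_one_of_mul_eq_one h3 with h | h
  · right
    ext <;> simp [h1, h2, h]
  · left
    ext <;> simp [h1, h2, h]

/-- A triangle around `0` of minimal normalized area is unimodular, unless `S` contains a pair of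
antipodal points. -/
lemma exists_unimodular_triangle_or_antipodal (hS : TriangleClosed S)
    (hw : HasIntegralSupports S) (N : ℕ) : ∀ a ∈ S, ∀ b ∈ S, ∀ c ∈ S,
      0 < cross a b → 0 < cross b c → 0 < cross c a →
      cross a b + cross b c + cross c a ≤ N →
      (∃ a ∈ S, ∃ b ∈ S, ∃ c ∈ S, cross a b = 1 ∧ cross b c = 1 ∧ cross c a = 1) ∨
        ∃ a ∈ S, a ≠ 0 ∧ -a ∈ S := by
  induction N with
  | zero => intro a _ b _ c _ h1 h2 h3 h4; push_cast at h4; omega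
  | succ N ih =>
    have step : ∀ a ∈ S, ∀ b ∈ S, ∀ c ∈ S, 1 < cross a b → 0 < cross b c → 0 < cross c a →
        cross a b + cross b c + cross c a ≤ (N + 1 : ℕ) →
        (∃ a ∈ S, ∃ b ∈ S, ∃ c ∈ S, cross a b = 1 ∧ cross b c = 1 ∧ cross c a = 1) ∨
          ∃ a ∈ S, a ≠ 0 ∧ -a ∈ S := by
      intro a ha b hb c hc hab hbc hca hN
      obtain ⟨d, hd, had, s, hs0, hsD, hsd⟩ :=
        exists_basis_completion hS hw ha hb (by omega : 0 < cross a b)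
      have hsd1 : cross a b * d.1 = s * a.1 + b.1 := by simpa using congrArg Prod.fst hsd
      have hsd2 : cross a b * d.2 = s * a.2 + b.2 := by simpa using congrArg Prod.snd hsd
      have hdb : cross d b = s := by
        apply mul_left_cancel₀ (by omega : cross a b ≠ 0)
        linear_combination (norm := (simp only [cross]; ring)) b.2 * hsd1 - b.1 * hsd2
      have hdc : cross a b * cross d c = cross b c - s * cross c a := by
        linear_combination (norm := (simp only [cross]; ring)) c.2 * hsd1 - c.1 * hsd2
      have hs : 0 < s := by
        refine lt_of_le_of_ne hs0 fun h0 => ?_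
        obtain ⟨w, hwb, -⟩ := hw b hb (ne_zero_left_of_cross_pos hbc)
        have : cross a b * -pairing w d = 1 := by
          subst h0
          linear_combination (norm := (simp only [pairing]; ring))
            -w.1 * hsd1 - w.2 * hsd2 - hwb
        rcases Int.eq_one_or_neg_one_of_mul_eq_one this with h | h <;> omega
      have hd0 : d ≠ 0 := ne_zero_right_of_cross_pos (a := a) (by omega)
      rcases lt_trichotomy (cross d c) 0 with h | h | h
      · have hcd : cross c d = -cross d c := by simp only [cross]; ring
        refine ih d hd b hb c hc (by omega) hbc (by omega) ?_
        have : cross c d < cross c a := by nlinarith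
        push_cast at hN
        omega
      · right
        refine ⟨d, hd, hd0, ?_⟩
        rcases eq_or_eq_neg_of_cross_eq_zero hw hd hc hd0 (ne_zero_left_of_cross_pos hca) h
          with rfl | rfl
        · have : cross a c = -cross c a := by simp only [cross]; ring
          omega
        · exact hc
      · refine ih a ha d hd c hc (by omega) h hca ?_
        have : cross d c < cross b c := by nlinarith
        push_cast at hN
        omega
    intro a ha b hb c hc hab hbc hca hN
    by_cases h1 : 1 < cross a b
    · exact step a ha b hb c hc h1 hbc hca hN
    by_cases h2 : 1 < cross b c
    · exact step b hb c hc a ha h2 hca hab (by omega)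
    by_cases h3 : 1 < cross c a
    · exact step c hc a ha b hb h3 hab hbc (by omega)
    exact Or.inl ⟨a, ha, b, hb, c, hc, by omega, by omega, by omega⟩

lemma PosSpanning.exists_cross_pos {W : Set (ℤ × ℤ)} (hspan : PosSpanning W) {a : ℤ × ℤ}
    (ha : a ≠ 0) : ∃ b ∈ W, 0 < cross a b := by
  have hu : ((a.2, -a.1) : ℤ × ℤ) ≠ 0 := by
    intro h
    rw [Prod.mk_eq_zero] at h
    exact ha (Prod.ext (by simpa using h.2) h.1)
  obtain ⟨b, hb, h⟩ := hspan _ hu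
  refine ⟨b, hb, ?_⟩
  simp only [pairing, cross] at *
  linarith

/-- A positively spanning set contains a triangle around `0` or an antipodal pair. -/
lemma exists_triangle_or_antipodal (hw : HasIntegralSupports S) {W : Set (ℤ × ℤ)}
    (hWS : W ⊆ S) (hfin : W.Finite) (hspan : PosSpanning W) :
    (∃ a ∈ S, ∃ b ∈ S, ∃ c ∈ S, 0 < cross a b ∧ 0 < cross b c ∧ 0 < cross c a) ∨
      ∃ a ∈ S, a ≠ 0 ∧ -a ∈ S := by
  obtain ⟨a, ha, h⟩ := hspan (1, 0) (by simp)
  have ha0 : a ≠ 0 := by rintro rfl; simp [pairing] at h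
  obtain ⟨b₀, hb₀, hab₀⟩ := hspan.exists_cross_pos ha0
  obtain ⟨b, ⟨hb, hab⟩, hmin⟩ :=
    (hfin.subset (Set.sep_subset W fun b => 0 < cross a b)).exists_minimalFor
    (fun b => (pairing a b : ℚ) / cross a b) _ ⟨b₀, hb₀, hab₀⟩
  obtain ⟨d, hd, hbd⟩ := hspan.exists_cross_pos (ne_zero_right_of_cross_pos hab)
  have had : cross a d ≤ 0 := by
    by_contra! had
    have hle : (pairing a b : ℚ) / cross a b ≤ pairing a d / cross a d := by
      rcases le_total ((pairing a b : ℚ) / cross a b) (pairing a d / cross a d) with h | h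
      exacts [h, hmin ⟨hd, had⟩ h]
    rw [div_le_div_iff₀ (by exact_mod_cast hab) (by exact_mod_cast had)] at hle
    have hle' : pairing a b * cross a d ≤ pairing a d * cross a b := by exact_mod_cast hle
    have hid : pairing a b * cross a d - pairing a d * cross a b =
        (a.1 ^ 2 + a.2 ^ 2) * cross b d := by
      simp only [pairing, cross]
      ring
    have hpos : 0 < a.1 ^ 2 + a.2 ^ 2 := by
      by_contra! hn
      exact ha0 (Prod.ext
        (by simpa using (by nlinarith [sq_nonneg a.1, sq_nonneg a.2] : a.1 ^ 2 = 0))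
        (by simpa using (by nlinarith [sq_nonneg a.1, sq_nonneg a.2] : a.2 ^ 2 = 0)))
    nlinarith [mul_pos hpos hbd]
  have hda : cross d a = -cross a d := by simp only [cross]; ring
  rcases had.lt_or_eq with had | had
  · exact Or.inl ⟨a, hWS ha, b, hWS hb, d, hWS hd, hab, hbd, by omega⟩
  · right
    refine ⟨a, hWS ha, ha0, ?_⟩
    rcases eq_or_eq_neg_of_cross_eq_zero hw (hWS ha) (hWS hd) ha0
      (ne_zero_right_of_cross_pos hbd) had with rfl | rfl
    · have : cross b d = -cross d b := by simp only [cross]; ring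
      omega
    · exact hWS hd

lemma cross_neg_neg (a b : ℤ × ℤ) : cross (-a) b = -cross a b := by
  simp only [cross, Prod.fst_neg, Prod.snd_neg]
  ring

/-- An antipodal pair and one point on either side contain a minimal configuration. -/
lemma exists_act_minimal_of_antipodal (hw : HasIntegralSupports S) {a b c : ℤ × ℤ} (ha : a ∈ S)
    (hna : -a ∈ S) (hb : b ∈ S) (hc : c ∈ S) (hab : cross a b = 1) (hac : cross a c = -1) :
    ∃ x y : ℤ × ℤ, cross x y * cross x y = 1 ∧
      ∃ M ∈ minimalPolygons, ∀ m ∈ M, act x y m ∈ S := by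
  have hc' : c = cross c b • a - b := by
    ext
    · simp only [Prod.smul_fst, Prod.fst_sub, smul_eq_mul]
      linear_combination (norm := (simp only [cross]; ring)) -c.1 * hab + b.1 * hac
    · simp only [Prod.smul_snd, Prod.snd_sub, smul_eq_mul]
      linear_combination (norm := (simp only [cross]; ring)) -c.2 * hab + b.2 * hac
  generalize cross c b = l at hc'
  have ha0 : a ≠ 0 := ne_zero_left_of_cross_pos (b := b) (by omega)
  obtain ⟨w, hwa, hwS⟩ := hw a ha ha0
  obtain ⟨z, hza, hzS⟩ := hw (-a) hna (neg_ne_zero.2 ha0)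
  have hwb := hwS b hb
  have hzb := hzS b hb
  have hwc : pairing w c = -l - pairing w b := by
    rw [hc']
    simp only [pairing, Prod.fst_sub, Prod.snd_sub, Prod.smul_fst, Prod.smul_snd, smul_eq_mul] at *
    linear_combination l * hwa
  have hzc : pairing z c = l - pairing z b := by
    rw [hc']
    simp only [pairing, Prod.fst_sub, Prod.snd_sub, Prod.smul_fst, Prod.smul_snd, smul_eq_mul,
      Prod.fst_neg, Prod.snd_neg] at *
    linear_combination -l * hza
  have h1 := hwS c hc
  have h2 := hzS c hc
  have hl : l = -2 ∨ l = -1 ∨ l = 0 ∨ l = 1 ∨ l = 2 := by omega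
  have hab' : a.1 * b.2 - a.2 * b.1 = 1 := hab
  rcases hl with rfl | rfl | rfl | rfl | rfl
  · refine ⟨a + b, a, ?_, [(1, -1), (-1, -1), (0, 1)], by simp [minimalPolygons], ?_⟩
    · have : cross (a + b) a = -1 := by
        simp only [cross, Prod.fst_add, Prod.snd_add]; linarith
      rw [this]; norm_num
    · intro m hm
      fin_cases hm
      · convert hb using 1; ext <;> simp [act]
      · convert hc using 1; rw [hc']; ext <;> simp [act] <;> ring
      · convert ha using 1; ext <;> simp [act]
  · refine ⟨a, b, by rw [hab]; norm_num, [(1, 0), (0, 1), (-1, -1)], by simp [minimalPolygons], ?_⟩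
    intro m hm
    fin_cases hm
    · convert ha using 1; ext <;> simp [act]
    · convert hb using 1; ext <;> simp [act]
    · convert hc using 1; rw [hc']; ext <;> simp [act] <;> ring
  · refine ⟨a, b, by rw [hab]; norm_num, [(1, 0), (0, 1), (-1, 0), (0, -1)],
      by simp [minimalPolygons], ?_⟩
    intro m hm
    fin_cases hm
    · convert ha using 1; ext <;> simp [act]
    · convert hb using 1; ext <;> simp [act]
    · convert hna using 1; ext <;> simp [act]
    · convert hc using 1; rw [hc']; ext <;> simp [act]
  · refine ⟨-a, b, by rw [cross_neg_neg, hab]; norm_num, [(1, 0), (0, 1), (-1, -1)],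
      by simp [minimalPolygons], ?_⟩
    intro m hm
    fin_cases hm
    · convert hna using 1; ext <;> simp [act]
    · convert hb using 1; ext <;> simp [act]
    · convert hc using 1; rw [hc']; ext <;> simp [act] <;> ring
  · refine ⟨-a + b, -a, ?_, [(1, -1), (-1, -1), (0, 1)], by simp [minimalPolygons], ?_⟩
    · have : cross (-a + b) (-a) = 1 := by
        simp only [cross, Prod.fst_add, Prod.snd_add, Prod.fst_neg, Prod.snd_neg]; linarith
      rw [this]; norm_num
    · intro m hm
      fin_cases hm
      · convert hb using 1; ext <;> simp [act]
      · convert hc using 1; rw [hc']; ext <;> simp [act] <;> ring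
      · convert hna using 1; ext <;> simp [act]

/-- Up to unimodular equivalence, `S` contains one of the three minimal configurations. -/
lemma exists_act_minimal (hS : TriangleClosed S) (hw : HasIntegralSupports S)
    {W : Set (ℤ × ℤ)} (hWS : W ⊆ S) (hfin : W.Finite) (hspan : PosSpanning W) :
    ∃ x y : ℤ × ℤ, cross x y * cross x y = 1 ∧
      ∃ M ∈ minimalPolygons, ∀ m ∈ M, act x y m ∈ S := by
  have antipodal : (∃ a ∈ S, a ≠ 0 ∧ -a ∈ S) → ∃ x y : ℤ × ℤ, cross x y * cross x y = 1 ∧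
      ∃ M ∈ minimalPolygons, ∀ m ∈ M, act x y m ∈ S := by
    rintro ⟨a, ha, ha0, hna⟩
    obtain ⟨b, hb, hab⟩ := hspan.exists_cross_pos ha0
    obtain ⟨c, hc, hac⟩ := hspan.exists_cross_pos (neg_ne_zero.2 ha0)
    obtain ⟨b', hb', hab', -⟩ := exists_basis_completion hS hw ha (hWS hb) hab
    obtain ⟨c', hc', hac', -⟩ := exists_basis_completion hS hw hna (hWS hc) hac
    rw [cross_neg_neg] at hac'
    exact exists_act_minimal_of_antipodal hw ha hna hb' hc' hab' (by omega)
  rcases exists_triangle_or_antipodal hw hWS hfin hspan with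
    ⟨a, ha, b, hb, c, hc, hab, hbc, hca⟩ | h
  · rcases exists_unimodular_triangle_or_antipodal hS hw
      (cross a b + cross b c + cross c a).toNat a ha b hb c hc hab hbc hca (by omega) with
      ⟨a, ha, b, hb, c, hc, hab, hbc, hca⟩ | h
    · refine ⟨a, b, by rw [hab]; norm_num, [(1, 0), (0, 1), (-1, -1)],
        by simp [minimalPolygons], ?_⟩
      intro m hm
      fin_cases hm
      · convert ha using 1; ext <;> simp [act]
      · convert hb using 1; ext <;> simp [act]
      · convert hc using 1
        ext
        · simp only [act]
          linear_combination (norm := (simp only [cross]; ring))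
            c.1 * hab + a.1 * hbc + b.1 * hca
        · simp only [act]
          linear_combination (norm := (simp only [cross]; ring))
            c.2 * hab + a.2 * hbc + b.2 * hca
    · exact antipodal h
  · exact antipodal h

end Lattice

/-! ### The sixteen polygons -/

/-- The vertices and the inner facet normals of the sixteen reflexive polygons. -/
def polygons : List (List (ℤ × ℤ) × List (ℤ × ℤ)) :=
  [([(-1, -1), (2, -1), (-1, 2)],
    [(-1, -1), (1, 0), (0, 1)]),
   ([(-1, -1), (1, -1), (1, 1), (-1, 1)],
    [(0, -1), (1, 0), (0, 1), (-1, 0)]),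
   ([(0, -1), (2, -1), (-1, 2), (-1, 0)],
    [(-1, -1), (1, 0), (1, 1), (0, 1)]),
   ([(-2, -1), (2, -1), (0, 1)],
    [(-1, -1), (1, -1), (0, 1)]),
   ([(0, -1), (2, -1), (-1, 2), (-1, 1)],
    [(-1, -1), (1, 0), (2, 1), (0, 1)]),
   ([(-1, -1), (1, -1), (1, 0), (0, 1), (-1, 1)],
    [(-1, -1), (0, -1), (1, 0), (0, 1), (-1, 0)]),
   ([(0, -1), (2, -1), (0, 1), (-1, 0)],
    [(-1, -1), (1, -1), (1, 1), (0, 1)]),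
   ([(-1, -1), (1, 0), (-1, 2)],
    [(-1, -1), (1, 0), (-1, 2)]),
   ([(-1, -1), (0, -1), (1, 0), (0, 1), (-1, 1)],
    [(-1, -1), (0, -1), (1, 0), (0, 1), (-1, 1)]),
   ([(0, -1), (1, -1), (1, 0), (0, 1), (-1, 1), (-1, 0)],
    [(-1, -1), (0, -1), (1, 0), (1, 1), (0, 1), (-1, 0)]),
   ([(0, -1), (1, -1), (1, 0), (0, 1), (-1, 1)],
    [(-1, -1), (0, -1), (2, 1), (0, 1), (-1, 0)]),
   ([(1, -1), (1, 1), (0, 1), (-1, 0)],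
    [(0, -1), (1, -1), (1, 2), (-1, 0)]),
   ([(0, -1), (1, 0), (0, 1), (-1, 0)],
    [(-1, -1), (1, -1), (1, 1), (-1, 1)]),
   ([(0, -1), (1, 0), (0, 1), (-1, 1)],
    [(-1, -1), (0, -1), (2, 1), (-1, 1)]),
   ([(2, -1), (0, 1), (-1, 0)],
    [(-1, -1), (1, -1), (1, 3)]),
   ([(-1, -1), (1, 0), (0, 1)],
    [(-1, -1), (2, -1), (-1, 2)])]

/-- The columns of the unimodular matrices that identify truncated polygons of the list. -/
def gluings : List ((ℤ × ℤ) × (ℤ × ℤ)) :=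
  [((1, 0), (0, 1)), ((-1, 1), (-1, 0)), ((-1, 0), (-1, 1)), ((0, 1), (1, 0)),
   ((1, -1), (0, -1)), ((-1, 0), (0, 1)), ((-1, 0), (0, -1)), ((-1, 1), (0, -1)),
   ((-1, 1), (0, 1)), ((0, 1), (-1, 0)), ((1, 0), (1, -1))]

/-- The lattice points with coordinates of absolute value at most `2`. -/
def box : List (ℤ × ℤ) := List.product [-2, -1, 0, 1, 2] [-2, -1, 0, 1, 2]

/-- The lattice points of the polygon with inner facet normals `W`, within the box. -/
def latticePoints (W : List (ℤ × ℤ)) : List (ℤ × ℤ) := box.filter fun p => InDual W p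

lemma polygons_certificate : ∀ Q ∈ polygons, FacetCertificate Q.1 Q.2 ∧
    FacetCertificate Q.2 Q.1 ∧ (∀ v ∈ Q.1, InDual Q.2 v) ∧ ∀ v ∈ Q.1, v ∈ box := by
  decide +kernel

lemma polygons_truncation : ∀ Q ∈ polygons, ∀ v ∈ Q.1,
    (∃ u ∈ box, u ≠ 0 ∧ ∀ p ∈ latticePoints Q.2, p ≠ v → 0 ≤ pairing u p) ∨
    ∃ Q' ∈ polygons, (latticePoints Q'.2).length < (latticePoints Q.2).length ∧
      ∃ g ∈ gluings, cross g.1 g.2 * cross g.1 g.2 = 1 ∧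
        ∀ p ∈ latticePoints Q.2, p ≠ v → InDual Q'.2 (act g.1 g.2 p) := by
  decide +kernel

lemma polygons_separation : ∀ Q ∈ polygons, ∀ Q' ∈ polygons, Q = Q' ∨
    ¬∃ a ∈ latticePoints Q'.2, ∃ b ∈ latticePoints Q'.2,
      (∀ p ∈ latticePoints Q.2, act a b p ∈ latticePoints Q'.2) ∧
      ∀ q ∈ latticePoints Q'.2, ∃ p ∈ latticePoints Q.2, act a b p = q := by
  decide +kernel

lemma basis_mem_latticePoints : ∀ Q ∈ polygons,
    (1, 0) ∈ latticePoints Q.2 ∧ (0, 1) ∈ latticePoints Q.2 := by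
  decide +kernel

lemma minimalPolygons_dual : ∀ M ∈ minimalPolygons, ∃ Q ∈ polygons, ∀ w ∈ Q.2, w ∈ M := by
  decide +kernel

lemma mem_latticePoints_iff {Q : List (ℤ × ℤ) × List (ℤ × ℤ)} (hQ : Q ∈ polygons) (p : ℤ × ℤ) :
    p ∈ latticePoints Q.2 ↔ InDual Q.2 p := by
  rw [latticePoints, List.mem_filter, decide_eq_true_iff, and_iff_right_iff_imp]
  intro hp
  obtain ⟨h, -, hVW, hbox⟩ := polygons_certificate Q hQ
  rw [← h.pt_mem_hull_iff hVW] at hp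
  have hcoord : ∀ v ∈ Q.1, -2 ≤ v.1 ∧ v.1 ≤ 2 ∧ -2 ≤ v.2 ∧ v.2 ≤ 2 := by
    intro v hv
    have hv' := hbox v hv
    obtain ⟨x, y⟩ := v
    rw [box, List.pair_mem_product] at hv'
    simp only [List.mem_cons, List.not_mem_nil, or_false] at hv'
    dsimp only
    omega
  have hbound (u : ℤ × ℤ) (hu : ∀ v ∈ Q.1, -2 ≤ pairing v u) : -2 ≤ pairing p u := by
    have := le_dotProd_of_mem_hull (y := pt u) (c := -2) (fun v hv => by
      rw [dotProd_pt]; exact_mod_cast hu v hv) hp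
    rw [dotProd_pt] at this
    exact_mod_cast this
  have h1 := hbound (1, 0) fun v hv => by have := hcoord v hv; simp [pairing]; omega
  have h2 := hbound (-1, 0) fun v hv => by have := hcoord v hv; simp [pairing]; omega
  have h3 := hbound (0, 1) fun v hv => by have := hcoord v hv; simp [pairing]; omega
  have h4 := hbound (0, -1) fun v hv => by have := hcoord v hv; simp [pairing]; omega
  obtain ⟨x, y⟩ := p
  simp only [pairing] at h1 h2 h3 h4
  rw [box, List.pair_mem_product]
  simp only [List.mem_cons, List.not_mem_nil]
  omega

lemma pt_mem_hull_polygon_iff {Q : List (ℤ × ℤ) × List (ℤ × ℤ)} (hQ : Q ∈ polygons) (p : ℤ × ℤ) :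
    pt p ∈ hull {p | p ∈ Q.1} ↔ p ∈ latticePoints Q.2 := by
  obtain ⟨h, -, hVW, -⟩ := polygons_certificate Q hQ
  rw [h.pt_mem_hull_iff hVW, mem_latticePoints_iff hQ]

/-- A positively spanning set of lattice points of a listed polygon has a listed hull: cut off
vertices until all the remaining ones are in the set. -/
lemma exists_latticeEquivTo_of_subset (N : ℕ) : ∀ Q ∈ polygons,
    (latticePoints Q.2).length ≤ N → ∀ T : Set (ℤ × ℤ), PosSpanning T →
      (∀ t ∈ T, t ∈ latticePoints Q.2) →
      ∃ Q' ∈ polygons, LatticeEquivTo (hull T) (hull {p | p ∈ Q'.1}) := by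
  induction N with
  | zero =>
    intro Q _ hlen T hT hTQ
    obtain ⟨t, ht, -⟩ := hT (1, 0) (by simp)
    simp [List.length_eq_zero_iff.1 (Nat.le_zero.1 hlen)] at hTQ
    exact absurd ht (hTQ _ _)
  | succ N ih =>
    intro Q hQ hlen T hT hTQ
    by_cases hall : ∀ v ∈ Q.1, v ∈ T
    · refine ⟨Q, hQ, ?_⟩
      have : hull T = hull {p | p ∈ Q.1} := by
        apply Set.Subset.antisymm
        · refine convexHull_min ?_ (convex_convexHull ℝ _)
          rintro _ ⟨t, ht, rfl⟩
          exact (pt_mem_hull_polygon_iff hQ t).2 (hTQ t ht)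
        · exact convexHull_mono (Set.image_mono hall)
      rw [this]
      exact LatticeEquivTo.refl _
    · push Not at hall
      obtain ⟨v, hv, hvT⟩ := hall
      have hne : ∀ t ∈ T, t ≠ v := fun t ht h => hvT (h ▸ ht)
      rcases polygons_truncation Q hQ v hv with
        ⟨u, -, hu, hnonneg⟩ | ⟨Q', hQ', hlt, g, -, hg, hmaps⟩
      · obtain ⟨t, ht, hneg⟩ := hT u hu
        exact absurd (hnonneg t (hTQ t ht) (hne t ht)) (not_le.2 hneg)
      · obtain ⟨R, hR, hequiv⟩ := ih Q' hQ' (by omega) (act g.1 g.2 '' T) (hT.image_act hg) (by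
          rintro _ ⟨t, ht, rfl⟩
          exact (mem_latticePoints_iff hQ' _).2 (hmaps t (hTQ t ht) (hne t ht)))
        exact ⟨R, hR, (latticeEquivTo_hull_act hg T).trans hequiv⟩

lemma eq_of_latticeEquivTo {Q Q' : List (ℤ × ℤ) × List (ℤ × ℤ)} (hQ : Q ∈ polygons)
    (hQ' : Q' ∈ polygons) (h : LatticeEquivTo (hull {p | p ∈ Q.1}) (hull {p | p ∈ Q'.1})) :
    Q = Q' := by
  obtain ⟨f, hf, himage⟩ := h
  refine (polygons_separation Q hQ Q' hQ').resolve_right (not_not.2 ?_)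
  obtain ⟨a, ha⟩ := exists_pt_of_isLatticePoint ((hf _).1 (isLatticePoint_pt (1, 0)))
  obtain ⟨b, hb⟩ := exists_pt_of_isLatticePoint ((hf _).1 (isLatticePoint_pt (0, 1)))
  have hact (p : ℤ × ℤ) : f (pt p) = pt (act a b p) := by
    have : pt p = (p.1 : ℝ) • pt (1, 0) + (p.2 : ℝ) • pt (0, 1) := by
      ext i
      fin_cases i <;> simp [pt]
    rw [this, map_add, map_smul, map_smul, ← ha, ← hb]
    ext i
    fin_cases i <;> simp [pt, act]
  have hmem (p : ℤ × ℤ) (hp : p ∈ latticePoints Q.2) : act a b p ∈ latticePoints Q'.2 := by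
    rw [← pt_mem_hull_polygon_iff hQ', ← hact, ← himage]
    exact ⟨_, (pt_mem_hull_polygon_iff hQ p).2 hp, rfl⟩
  have hbasis := basis_mem_latticePoints Q hQ
  refine ⟨a, ?_, b, ?_, hmem, fun q hq => ?_⟩
  · simpa [act] using hmem _ hbasis.1
  · simpa [act] using hmem _ hbasis.2
  · rw [← pt_mem_hull_polygon_iff hQ', ← himage] at hq
    obtain ⟨x, hx, hxq⟩ := hq
    obtain ⟨p, rfl⟩ := exists_pt_of_isLatticePoint ((hf x).2 (hxq ▸ isLatticePoint_pt q))
    exact ⟨p, (pt_mem_hull_polygon_iff hQ p).1 hx, pt_injective (by rw [← hact, hxq])⟩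

/-! ### Reflexive polygons -/

lemma exists_smul_mem_of_zero_mem_interior {P : Set (Fin 2 → ℝ)} (h : 0 ∈ interior P)
    (y : Fin 2 → ℝ) : ∃ ε : ℝ, 0 < ε ∧ ε • y ∈ P := by
  have htend : Filter.Tendsto (fun ε : ℝ => ε • y) (nhdsWithin 0 (Set.Ioi 0)) (nhds 0) :=
    ((continuous_id.smul continuous_const).tendsto' 0 0 (zero_smul ℝ y)).mono_left
      nhdsWithin_le_nhds
  have hpos : ∀ᶠ ε : ℝ in nhdsWithin 0 (Set.Ioi 0), 0 < ε := self_mem_nhdsWithin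
  obtain ⟨ε, hε, hmem⟩ :=
    (hpos.and (htend.eventually (mem_interior_iff_mem_nhds.1 h))).exists
  exact ⟨ε, hε, hmem⟩

lemma exists_smul_mem_dualPolytope_hull {T : Set (ℤ × ℤ)} (hT : T.Finite) (y : Fin 2 → ℝ) :
    ∃ ε : ℝ, 0 < ε ∧ ε • y ∈ dualPolytope (hull T) := by
  obtain ⟨c, hc⟩ := (hT.image fun t => dotProd (pt t) y).bddBelow
  refine ⟨(|c| + 1)⁻¹, by positivity, mem_dualPolytope_hull.2 fun t ht => ?_⟩
  have hct : c ≤ dotProd (pt t) y := hc ⟨t, ht, rfl⟩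
  have hsmul : dotProd (pt t) ((|c| + 1)⁻¹ • y) = dotProd (pt t) y / (|c| + 1) := by
    simp only [dotProd_pt_left, Pi.smul_apply, smul_eq_mul]
    field_simp
  rw [hsmul, le_div_iff₀ (by positivity)]
  linarith [neg_abs_le c]

lemma posSpanning_of_absorbing {T : Set (ℤ × ℤ)}
    (h : ∀ y : Fin 2 → ℝ, ∃ ε : ℝ, 0 < ε ∧ ε • y ∈ hull T) : PosSpanning T := by
  intro u hu
  by_contra! hnonneg
  obtain ⟨ε, hε, hmem⟩ := h (-pt u)
  have hle : 0 ≤ dotProd (ε • -pt u) (pt u) := by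
    refine le_dotProd_of_mem_hull (fun t ht => ?_) hmem
    rw [dotProd_swap, dotProd_pt]
    exact_mod_cast hnonneg t ht
  have heq : dotProd (ε • -pt u) (pt u) = -(ε * ((u.1 : ℝ) ^ 2 + (u.2 : ℝ) ^ 2)) := by
    simp only [dotProd, Fin.sum_univ_two, pt, Pi.smul_apply, Pi.neg_apply, smul_eq_mul,
      Matrix.cons_val_zero, Matrix.cons_val_one]
    ring
  have hsq : (u.1 : ℝ) ^ 2 + (u.2 : ℝ) ^ 2 ≤ 0 := by
    by_contra! hpos
    nlinarith [mul_pos hε hpos]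
  apply hu
  ext
  · have : (u.1 : ℝ) = 0 := by nlinarith [sq_nonneg (u.1 : ℝ), sq_nonneg (u.2 : ℝ)]
    exact_mod_cast this
  · have : (u.2 : ℝ) = 0 := by nlinarith [sq_nonneg (u.1 : ℝ), sq_nonneg (u.2 : ℝ)]
    exact_mod_cast this

lemma triangleClosed_of_convex {P : Set (Fin 2 → ℝ)} (hP : Convex ℝ P) (h0 : 0 ∈ P) :
    TriangleClosed {p | pt p ∈ P} := by
  intro a ha b hb d k p q hk hp hq hpq hd
  have hk' : (0 : ℝ) < k := by exact_mod_cast hk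
  have hp' : (0 : ℝ) ≤ p := by exact_mod_cast hp
  have hq' : (0 : ℝ) ≤ q := by exact_mod_cast hq
  have hpq' : (p : ℝ) + q ≤ k := by exact_mod_cast hpq
  have hmem := smul_add_smul_mem_of_zero_mem hP h0 ha hb (div_nonneg hp' hk'.le)
    (div_nonneg hq' hk'.le) (by rwa [← add_div, div_le_one hk'])
  have hd1 : (k : ℝ) * d.1 = p * a.1 + q * b.1 := by
    exact_mod_cast (by simpa using congrArg Prod.fst hd : k * d.1 = p * a.1 + q * b.1)
  have hd2 : (k : ℝ) * d.2 = p * a.2 + q * b.2 := by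
    exact_mod_cast (by simpa using congrArg Prod.snd hd : k * d.2 = p * a.2 + q * b.2)
  rw [Set.mem_ofPred_eq]
  convert hmem using 1
  ext i
  fin_cases i
  · simp only [pt, Fin.zero_eta, Pi.add_apply, Pi.smul_apply, smul_eq_mul, Matrix.cons_val_zero]
    field_simp
    linarith
  · simp only [pt, Fin.mk_one, Pi.add_apply, Pi.smul_apply, smul_eq_mul, Matrix.cons_val_one,
      Matrix.cons_val_zero]
    field_simp
    linarith

lemma hasIntegralSupports_dual {T : Set (ℤ × ℤ)} (hT : PosSpanning T) :
    HasIntegralSupports {p | pt p ∈ dualPolytope (hull T)} := by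
  have hmem (q : ℤ × ℤ) (hq : pt q ∈ dualPolytope (hull T)) (t) (ht : t ∈ T) :
      -1 ≤ pairing t q := by
    have := mem_dualPolytope_hull.1 hq t ht
    rw [dotProd_pt] at this
    exact_mod_cast this
  intro p hp hp0
  obtain ⟨t, ht, hneg⟩ := hT p hp0
  have hcomm : pairing t p = pairing p t := by simp only [pairing]; ring
  have := hmem p hp t ht
  exact ⟨t, by omega, fun q hq => hmem q hq t ht⟩

lemma exists_polygon_of_isReflexive {P : Set (Fin 2 → ℝ)} (hP : IsReflexive P) :
    ∃ Q ∈ polygons, LatticeEquivTo P (hull {p | p ∈ Q.1}) := by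
  obtain ⟨hPpoly, hP0, hdual⟩ := hP
  obtain ⟨T, hTfin, rfl⟩ := (isLatticePolytope_iff_hull _).1 hPpoly
  obtain ⟨W, hWfin, hW⟩ := (isLatticePolytope_iff_hull _).1 hdual
  have hT : PosSpanning T := posSpanning_of_absorbing (exists_smul_mem_of_zero_mem_interior hP0)
  have hWspan : PosSpanning W :=
    posSpanning_of_absorbing (hW ▸ exists_smul_mem_dualPolytope_hull hTfin)
  have hzero : (0 : Fin 2 → ℝ) ∈ dualPolytope (hull T) := by
    intro x _
    simp [dotProd]
  obtain ⟨a, b, hab, M, hM, hMS⟩ := exists_act_minimal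
    (triangleClosed_of_convex (convex_dualPolytope _) hzero) (hasIntegralSupports_dual hT)
    (W := W) (fun w hw => hW ▸ pt_mem_hull hw) hWfin hWspan
  obtain ⟨Q, hQ, hQM⟩ := minimalPolygons_dual M hM
  have hab' : cross (a.1, b.1) (a.2, b.2) * cross (a.1, b.1) (a.2, b.2) = 1 := by
    rw [← hab]
    simp only [cross]
    ring
  obtain ⟨R, hR, hequiv⟩ := exists_latticeEquivTo_of_subset _ Q hQ le_rfl
    (act (a.1, b.1) (a.2, b.2) '' T) (hT.image_act hab') (by
      rintro _ ⟨t, ht, rfl⟩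
      rw [mem_latticePoints_iff hQ]
      intro w hw
      have := mem_dualPolytope_hull.1 (hMS w (hQM w hw)) t ht
      rw [dotProd_pt] at this
      have heq : pairing w (act (a.1, b.1) (a.2, b.2) t) = pairing t (act a b w) := by
        simp only [pairing, act]
        ring
      rw [heq]
      exact_mod_cast this)
  exact ⟨R, hR, (latticeEquivTo_hull_act hab' T).trans hequiv⟩

/-- There are exactly 16 two-dimensional reflexive polytopes up to unimodular
equivalence. -/
theorem sixteen_reflexive_polygons :
    ∃ L : Finset (Set (Fin 2 → ℝ)), L.card = 16 ∧
      (∀ Q ∈ L, IsReflexive Q) ∧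
      (∀ P : Set (Fin 2 → ℝ), IsReflexive P → ∃ Q ∈ L, LatticeEquivTo P Q) ∧
      (∀ Q ∈ L, ∀ Q' ∈ L, LatticeEquivTo Q Q' → Q = Q') := by
  classical
  have hinj : ∀ Q ∈ polygons, ∀ Q' ∈ polygons,
      hull {p | p ∈ Q.1} = hull {p | p ∈ Q'.1} → Q = Q' := fun Q hQ Q' hQ' h =>
    eq_of_latticeEquivTo hQ hQ' (h ▸ LatticeEquivTo.refl _)
  refine ⟨(polygons.map fun Q => hull {p | p ∈ Q.1}).toFinset, ?_, ?_, ?_, ?_⟩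
  · rw [List.toFinset_card_of_nodup, List.length_map]
    · rfl
    · exact (by decide +kernel : polygons.Nodup).map_on hinj
  · intro P hP
    obtain ⟨Q, hQ, rfl⟩ := List.mem_map.1 (List.mem_toFinset.1 hP)
    obtain ⟨h, h', hVW, -⟩ := polygons_certificate Q hQ
    exact h.isReflexive h' hVW
  · intro P hP
    obtain ⟨Q, hQ, hequiv⟩ := exists_polygon_of_isReflexive hP
    exact ⟨_, List.mem_toFinset.2 (List.mem_map_of_mem hQ), hequiv⟩
  · intro P hP P' hP' hequiv
    obtain ⟨Q, hQ, rfl⟩ := List.mem_map.1 (List.mem_toFinset.1 hP)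
    obtain ⟨Q', hQ', rfl⟩ := List.mem_map.1 (List.mem_toFinset.1 hP')
    rw [eq_of_latticeEquivTo hQ hQ' hequiv]

end
end
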